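/- arXiv:2204.03459 — 2 statements merged into one kernel-verified Lean document; each statement's English description precedes it below -/
import Mathlib

section
/- Let V be a mixed lattice vector space equipped with a vector topology. Then the following are mutually equivalent: (a) the map (x,y) ↦ x⌣y is uniformly continuous; (b) the map (x,y) ↦ x⌢y is uniformly continuous; (c) the map x ↦ ᵘx = x⌣0 is uniformly continuous; (d) the map x ↦ ˡx = (−x)⌣0 is uniformly continuous; (e) the map x ↦ (−x)⌣x is uniformly continuous; (f) the map x ↦ x⌣(−x) is uniformly continuous; (g) the map x ↦ xˡ = 0⌣(−x) is uniformly continuous; (h) the map x ↦ xᵘ = 0⌣x is uniformly continuous. -/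
/-- A mixed lattice vector space: a real vector space with two partial orders
(the initial order `le` and the specific order `sle`), each making it a partially
ordered vector space, such that the mixed upper and lower envelopes `up` and `down`
exist, `sle` implies `le`, and the specific cone is a mixed lattice cone. -/
structure MixedLattice (V : Type*) [AddCommGroup V] [Module ℝ V] where
  le : V → V → Prop
  sle : V → V → Prop
  le_refl : ∀ x, le x x
  le_trans : ∀ {x y z}, le x y → le y z → le x z
  le_antisymm : ∀ {x y}, le x y → le y x → x = y
  sle_refl : ∀ x, sle x x
  sle_trans : ∀ {x y z}, sle x y → sle y z → sle x z
  sle_antisymm : ∀ {x y}, sle x y → sle y x → x = y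
  le_add : ∀ {x y} (z : V), le x y → le (x + z) (y + z)
  le_smul : ∀ {a : ℝ}, 0 ≤ a → ∀ {x y}, le x y → le (a • x) (a • y)
  sle_add : ∀ {x y} (z : V), sle x y → sle (x + z) (y + z)
  sle_smul : ∀ {a : ℝ}, 0 ≤ a → ∀ {x y}, sle x y → sle (a • x) (a • y)
  /-- the mixed upper envelope `x ⌣ y` -/
  up : V → V → V
  /-- the mixed lower envelope `x ⌢ y` -/
  down : V → V → V
  up_mem₁ : ∀ x y, sle x (up x y)
  up_mem₂ : ∀ x y, le y (up x y)
  up_min : ∀ x y w, sle x w → le y w → le (up x y) w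
  down_mem₁ : ∀ x y, sle (down x y) x
  down_mem₂ : ∀ x y, le (down x y) y
  down_max : ∀ x y w, sle w x → le w y → le w (down x y)
  sle_imp_le : ∀ {x y}, sle x y → le x y
  up_cone : ∀ {x y}, sle 0 x → sle 0 y → sle 0 (up x y)
  down_cone : ∀ {x y}, sle 0 x → sle 0 y → sle 0 (down x y)

namespace MixedLattice

variable {V : Type*} [AddCommGroup V] [Module ℝ V] (M : MixedLattice V)

/-- the specific upper part `xᵘ = 0 ⌣ x` -/
def supp (x : V) : V := M.up 0 x

/-- the specific lower part `xˡ = 0 ⌣ (-x)` -/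
def slowp (x : V) : V := M.up 0 (-x)

/-- the upper part `ᵘx = x ⌣ 0` -/
def upp (x : V) : V := M.up x 0

/-- the lower part `ˡx = (-x) ⌣ 0` -/
def lowp (x : V) : V := M.up (-x) 0

/-- the symmetric generalized absolute value `s(x) = (1/2)((x⌣(−x)) + ((−x)⌣x))` -/
noncomputable def sabs (x : V) : V := (1 / 2 : ℝ) • (M.up x (-x) + M.up (-x) x)

/-- the type 1 mixed-full hull `MF₁(A) = {y : x ≼ y ≤ z for some x, z ∈ A}` -/
def MF1 (A : Set V) : Set V := {y | ∃ x ∈ A, ∃ z ∈ A, M.sle x y ∧ M.le y z}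

/-- the type 2 mixed-full hull `MF₂(A) = {y : x ≤ y ≼ z for some x, z ∈ A}` -/
def MF2 (A : Set V) : Set V := {y | ∃ x ∈ A, ∃ z ∈ A, M.le x y ∧ M.sle y z}

/-- `MS₁(A) = {y : −s(x) ≼ y ≤ s(x) for some x ∈ A}` -/
def MS1 (A : Set V) : Set V := {y | ∃ x ∈ A, M.sle (-M.sabs x) y ∧ M.le y (M.sabs x)}

/-- `MS₂(A) = {y : −s(x) ≤ y ≼ s(x) for some x ∈ A}` -/
def MS2 (A : Set V) : Set V := {y | ∃ x ∈ A, M.le (-M.sabs x) y ∧ M.sle y (M.sabs x)}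

/-- a set is symmetric-solid if `x ∈ A` and `s(y) ≤ s(x)` imply `y ∈ A` -/
def SymmSolid (A : Set V) : Prop := ∀ x ∈ A, ∀ y, M.le (M.sabs y) (M.sabs x) → y ∈ A

/-- a set is (≤)-full if `x, y ∈ S` and `y ≤ z ≤ x` imply `z ∈ S` -/
def LeFull (S : Set V) : Prop := ∀ x ∈ S, ∀ y ∈ S, ∀ z, M.le y z → M.le z x → z ∈ S

/-- a set is (≼)-full if `x, y ∈ S` and `y ≼ z ≼ x` imply `z ∈ S` -/
def SleFull (S : Set V) : Prop := ∀ x ∈ S, ∀ y ∈ S, ∀ z, M.sle y z → M.sle z x → z ∈ S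

/-- a linear subspace, as a set -/
def IsSubspace (S : Set V) : Prop :=
  (0 : V) ∈ S ∧ (∀ x ∈ S, ∀ y ∈ S, x + y ∈ S) ∧ ∀ (a : ℝ), ∀ x ∈ S, a • x ∈ S

/-- a mixed lattice subspace -/
def IsMLSubspace (S : Set V) : Prop :=
  IsSubspace S ∧ ∀ x ∈ S, ∀ y ∈ S, M.up x y ∈ S ∧ M.down x y ∈ S

section Topology

variable [TopologicalSpace V]

/-- uniform continuity of a map `V → V` with respect to a vector topology -/
def UnifCont (f : V → V) : Prop :=
  ∀ W ∈ nhds (0 : V), ∃ U ∈ nhds (0 : V), ∀ x y : V, x - y ∈ U → f x - f y ∈ W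

/-- uniform continuity of a map `V × V → V` with respect to a vector topology -/
def UnifCont2 (g : V → V → V) : Prop :=
  ∀ W ∈ nhds (0 : V), ∃ U ∈ nhds (0 : V),
    ∀ x x' y y' : V, x - x' ∈ U → y - y' ∈ U → g x y - g x' y' ∈ W

/-- the topology is locally mixed-full: every neighborhood of zero contains a
type 1 mixed-full neighborhood of zero -/
def LocallyMixedFull : Prop :=
  ∀ U ∈ nhds (0 : V), ∃ W ∈ nhds (0 : V), W ⊆ U ∧ M.MF1 W = W

/-- the topology has a neighborhood base at zero of symmetric-solid sets -/
def LocallySymmSolid : Prop :=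
  ∀ U ∈ nhds (0 : V), ∃ W ∈ nhds (0 : V), W ⊆ U ∧ M.SymmSolid W

/-- the topology has a neighborhood base at zero of (≤)-full sets -/
def LocallyLeFull : Prop :=
  ∀ U ∈ nhds (0 : V), ∃ W ∈ nhds (0 : V), W ⊆ U ∧ M.LeFull W

/-- the mixed lattice operations are continuous at zero -/
def ContAtZero : Prop :=
  ContinuousAt (fun p : V × V => M.up p.1 p.2) ((0 : V), (0 : V)) ∧
  ContinuousAt (fun p : V × V => M.down p.1 p.2) ((0 : V), (0 : V))

end Topology

end MixedLattice

open Topology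

namespace MixedLattice

section Envelopes

variable {V : Type*} [AddCommGroup V] [Module ℝ V] (M : MixedLattice V)

theorem up_add_le (x y z : V) : M.le (M.up (x + z) (y + z)) (M.up x y + z) :=
  M.up_min _ _ _ (M.sle_add z (M.up_mem₁ x y)) (M.le_add z (M.up_mem₂ x y))

/-- The mixed upper envelope is translation invariant. -/
theorem up_add (x y z : V) : M.up (x + z) (y + z) = M.up x y + z := by
  refine M.le_antisymm (M.up_add_le x y z) ?_
  simpa using M.le_add z (M.up_add_le (x + z) (y + z) (-z))

theorem up_eq_up_zero_add (x y : V) : M.up x y = M.up 0 (y - x) + x := by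
  simpa using M.up_add 0 (y - x) x

theorem le_neg_neg {x y : V} (h : M.le x y) : M.le (-y) (-x) := by
  have := M.le_add (-x + -y) h
  rwa [add_neg_cancel_left, add_left_comm, add_neg_cancel, add_zero] at this

theorem sle_neg_neg {x y : V} (h : M.sle x y) : M.sle (-y) (-x) := by
  have := M.sle_add (-x + -y) h
  rwa [add_neg_cancel_left, add_left_comm, add_neg_cancel, add_zero] at this

theorem down_eq_neg_up_neg (x y : V) : M.down x y = -M.up (-x) (-y) := by
  apply M.le_antisymm
  · simpa using M.le_neg_neg (M.up_min _ _ _ (M.sle_neg_neg (M.down_mem₁ x y))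
      (M.le_neg_neg (M.down_mem₂ x y)))
  · apply M.down_max
    · simpa using M.sle_neg_neg (M.up_mem₁ (-x) (-y))
    · simpa using M.le_neg_neg (M.up_mem₂ (-x) (-y))

theorem up_eq_neg_down_neg (x y : V) : M.up x y = -M.down (-x) (-y) := by
  simp [down_eq_neg_up_neg]

end Envelopes

section Uniform

variable {V : Type*} [AddCommGroup V] [UniformSpace V] [IsUniformAddGroup V]

theorem unifCont_iff_uniformContinuous {f : V → V} : UnifCont f ↔ UniformContinuous f := by
  have hb := uniformity_eq_comap_nhds_zero_swapped V ▸ (𝓝 (0 : V)).basis_sets.comap _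
  rw [hb.uniformContinuous_iff hb]
  rfl

theorem unifCont2_iff_uniformContinuous {g : V → V → V} :
    UnifCont2 g ↔ UniformContinuous fun p : V × V => g p.1 p.2 := by
  have hb := uniformity_eq_comap_nhds_zero_swapped V ▸ (𝓝 (0 : V)).basis_sets.comap _
  have hb₂ := uniformity_eq_comap_nhds_zero_swapped (V × V) ▸
    (nhds_prod_eq (x := (0 : V)) (y := (0 : V)) ▸
      (𝓝 (0 : V)).basis_sets.prod_self).comap _
  rw [hb₂.uniformContinuous_iff hb]
  refine forall₂_congr fun W _ => exists_congr fun U => and_congr_right fun _ => ?_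
  exact ⟨fun h p q hpq => h p.1 q.1 p.2 q.2 hpq.1 hpq.2,
    fun h x x' y y' hx hy => h (x, y) (x', y') ⟨hx, hy⟩⟩

end Uniform

end MixedLattice

/-- equivalence of uniform continuity of the mixed lattice operations
and of the various (specific) upper/lower part maps and generalized absolute values. -/
theorem stmt_1 {V : Type*} [AddCommGroup V] [Module ℝ V] (M : MixedLattice V)
    [TopologicalSpace V] [ContinuousAdd V] [ContinuousSMul ℝ V] :
    List.TFAE
      [ MixedLattice.UnifCont2 M.up,                                -- (a) (x,y) ↦ x⌣y
        MixedLattice.UnifCont2 M.down,                              -- (b) (x,y) ↦ x⌢y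
        MixedLattice.UnifCont (fun x : V => M.up x 0),              -- (c) x ↦ ᵘx
        MixedLattice.UnifCont (fun x : V => M.up (-x) 0),           -- (d) x ↦ ˡx
        MixedLattice.UnifCont (fun x : V => M.up (-x) x),           -- (e) x ↦ (−x)⌣x
        MixedLattice.UnifCont (fun x : V => M.up x (-x)),           -- (f) x ↦ x⌣(−x)
        MixedLattice.UnifCont (fun x : V => M.up 0 (-x)),           -- (g) x ↦ xˡ
        MixedLattice.UnifCont (fun x : V => M.up 0 x) ] := by       -- (h) x ↦ xᵘ
  have : ContinuousNeg V := ContinuousNeg.of_continuousConstSMul ℝ V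
  have : IsTopologicalAddGroup V := {}
  let : UniformSpace V := IsTopologicalAddGroup.rightUniformSpace V
  have : IsUniformAddGroup V := isUniformAddGroup_of_addCommGroup
  have : UniformContinuousConstSMul ℝ V := uniformContinuousConstSMul_of_continuousConstSMul ℝ V
  simp only [MixedLattice.unifCont_iff_uniformContinuous,
    MixedLattice.unifCont2_iff_uniformContinuous]
  have half_add_half (x : V) : (1 / 2 : ℝ) • x + (1 / 2 : ℝ) • x = x := by
    rw [← add_smul]; norm_num
  have hneg : UniformContinuous fun x : V => -x := uniformContinuous_neg
  have hhalf : UniformContinuous fun x : V => (1 / 2 : ℝ) • x := uniformContinuous_const_smul _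
  have hzero : UniformContinuous fun _ : V => (0 : V) := uniformContinuous_const
  have up_zero_eq (x : V) : M.up 0 x = M.up (-x) 0 + x := by simpa using M.up_add (-x) 0 x
  have up_zero_eq_half (x : V) :
      M.up 0 x = M.up (-((1 / 2 : ℝ) • x)) ((1 / 2 : ℝ) • x) + (1 / 2 : ℝ) • x := by
    rw [← M.up_add, neg_add_cancel, half_add_half]
  tfae_have 1 → 2 := fun h => by
    simpa only [M.down_eq_neg_up_neg, Function.comp_def, Prod.map] using
      (h.comp (hneg.prodMap hneg)).neg
  tfae_have 2 → 1 := fun h => by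
    simpa only [M.up_eq_neg_down_neg, Function.comp_def, Prod.map] using
      (h.comp (hneg.prodMap hneg)).neg
  tfae_have 1 → 3 := fun h => h.comp (uniformContinuous_id.prodMk hzero)
  tfae_have 1 → 4 := fun h => h.comp (hneg.prodMk hzero)
  tfae_have 1 → 5 := fun h => h.comp (hneg.prodMk uniformContinuous_id)
  tfae_have 1 → 6 := fun h => h.comp (uniformContinuous_id.prodMk hneg)
  tfae_have 1 → 7 := fun h => h.comp (hzero.prodMk hneg)
  tfae_have 3 → 8 := fun h => by
    simpa only [up_zero_eq, Function.comp_def, id] using (h.comp hneg).add uniformContinuous_id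
  tfae_have 4 → 8 := fun h => by
    simpa only [up_zero_eq, id] using h.add uniformContinuous_id
  tfae_have 5 → 8 := fun h => by
    simpa only [up_zero_eq_half, Function.comp_def] using (h.comp hhalf).add hhalf
  tfae_have 6 → 8 := fun h => by
    simpa only [up_zero_eq_half, Function.comp_def, neg_neg] using
      (h.comp (hneg.comp hhalf)).add hhalf
  tfae_have 7 → 8 := fun h => by
    simpa only [Function.comp_def, neg_neg] using h.comp hneg
  tfae_have 8 → 1 := fun h => by
    rw [show (fun p : V × V => M.up p.1 p.2) = fun p => M.up 0 (p.2 - p.1) + p.1 from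
      funext fun p => M.up_eq_up_zero_add p.1 p.2]
    exact (h.comp (uniformContinuous_snd.sub uniformContinuous_fst)).add uniformContinuous_fst
  tfae_finish
end

section
/- Let V be a mixed lattice vector space and p a seminorm on V. Then p is a mixed lattice seminorm if and only if p is mixed-monotone and p(s(x)) = p(x) for all x ∈ V. -/
namespace MixedLattice

variable {V : Type*} [AddCommGroup V] [Module ℝ V] (M : MixedLattice V)

theorem le_add_add {a b c d : V} (h₁ : M.le a b) (h₂ : M.le c d) : M.le (a + c) (b + d) := by
  have h := M.le_add b h₂
  rw [add_comm c, add_comm d] at h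
  exact M.le_trans (M.le_add c h₁) h

theorem sle_add_add {a b c d : V} (h₁ : M.sle a b) (h₂ : M.sle c d) :
    M.sle (a + c) (b + d) := by
  have h := M.sle_add b h₂
  rw [add_comm c, add_comm d] at h
  exact M.sle_trans (M.sle_add c h₁) h

/-- The symmetric absolute value is specifically positive. -/
theorem sle_zero_sabs (x : V) : M.sle 0 (M.sabs x) := by
  have h := M.sle_smul (a := 1 / 2) (by norm_num)
    (M.sle_add_add (M.up_mem₁ x (-x)) (M.up_mem₁ (-x) x))
  rwa [add_neg_cancel, smul_zero] at h

theorem le_sabs (x : V) : M.le x (M.sabs x) := by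
  have h := M.le_smul (a := 1 / 2) (by norm_num)
    (M.le_add_add (M.sle_imp_le (M.up_mem₁ x (-x))) (M.up_mem₂ (-x) x))
  rwa [← two_smul ℝ x, smul_smul, one_div, inv_mul_cancel₀ two_ne_zero, one_smul,
    ← one_div] at h

/-- The symmetric absolute value fixes the specifically positive elements. -/
theorem sabs_of_sle_zero {x : V} (hx : M.sle 0 x) : M.sabs x = x := by
  have hneg : M.sle (-x) x := by
    have h := M.sle_add (-x) hx
    rw [zero_add, add_neg_cancel] at h
    exact M.sle_trans h hx
  have h₁ : M.up x (-x) = x :=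
    M.le_antisymm (M.up_min _ _ _ (M.sle_refl x) (M.sle_imp_le hneg))
      (M.sle_imp_le (M.up_mem₁ _ _))
  have h₂ : M.up (-x) x = x :=
    M.le_antisymm (M.up_min _ _ _ hneg (M.le_refl x)) (M.up_mem₂ _ _)
  rw [sabs, h₁, h₂, ← two_smul ℝ x, smul_smul, one_div, inv_mul_cancel₀ two_ne_zero, one_smul]

theorem sabs_sabs (x : V) : M.sabs (M.sabs x) = M.sabs x :=
  M.sabs_of_sle_zero (M.sle_zero_sabs x)

end MixedLattice

/-- a seminorm is a mixed lattice seminorm if and only if it is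
mixed-monotone and `p(s(x)) = p(x)` for all `x`. -/
theorem stmt_13 {V : Type*} [AddCommGroup V] [Module ℝ V] (M : MixedLattice V)
    (p : Seminorm ℝ V) :
    (∀ x y : V, M.le (M.sabs x) (M.sabs y) → p x ≤ p y) ↔
      ((∀ x y : V, M.sle 0 x → M.le x y → p x ≤ p y) ∧
        ∀ x : V, p (M.sabs x) = p x) := by
  constructor
  · intro h
    refine ⟨fun x y hx hxy => h x y ?_, fun x => _root_.le_antisymm (h _ _ ?_) (h _ _ ?_)⟩
    · rw [M.sabs_of_sle_zero hx]
      exact M.le_trans hxy (M.le_sabs y)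
    · rw [M.sabs_sabs]
      exact M.le_refl _
    · rw [M.sabs_sabs]
      exact M.le_refl _
  · rintro ⟨hmono, hs⟩ x y hxy
    rw [← hs x, ← hs y]
    exact hmono _ _ (M.sle_zero_sabs x) hxy
end
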